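/- Let N ≥ 2, h : Fin N → ℝ with all values positive and pairwise distinct, λ : Fin N → ℝ with 0 < λ i for all i, and let m be the index maximizing h and m' the index of the second-largest value of h. For real C define ρ_i(C) = λ i * (h i)^C / (∑ j, λ j * (h j)^C) and the second-stage probability ρ_i^{[2]}(C) = ∑_{j ≠ i} ρ_j(C) * ρ_i(C) / (1 − ρ_j(C)). Then as C → ∞, ρ_m^{[2]}(C) → 0, ρ_{m'}^{[2]}(C) → 1, and ρ_i^{[2]}(C) → 0 for every i ∉ {m, m'}. -/

import Mathlib

open Filter Finset

/-- Among finitely many exponentially weighted terms, the share of each one tends to the indicator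
of the dominant index. -/
theorem tendsto_weighted_rpow_div_sum {ι : Type*} [DecidableEq ι] {h lam : ι → ℝ}
    (hpos : ∀ i, 0 < h i) (lampos : ∀ i, 0 < lam i) {s : Finset ι} {k : ι} (hk : k ∈ s)
    (hmax : ∀ j ∈ s, j ≠ k → h j < h k) {i : ι} (hi : i ∈ s) :
    Tendsto (fun C : ℝ => lam i * h i ^ C / ∑ j ∈ s, lam j * h j ^ C) atTop
      (nhds (if i = k then 1 else 0)) := by
  have ratio : ∀ j ∈ s, Tendsto (fun C : ℝ => lam j * (h j / h k) ^ C) atTop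
      (nhds (if j = k then lam k else 0)) := by
    intro j hj
    split_ifs with hjk
    · subst hjk
      simp [div_self (hpos j).ne']
    · have := (tendsto_rpow_atTop_of_base_lt_one (h j / h k)
        (by linarith [div_pos (hpos j) (hpos k)])
        ((div_lt_one (hpos k)).2 (hmax j hj hjk))).const_mul (lam j)
      simpa using this
  have hsum := tendsto_finsetSum s ratio
  rw [Finset.sum_ite_eq' s k, if_pos hk] at hsum
  have key := (ratio i hi).div hsum (lampos k).ne'
  have hlim : (if i = k then lam k else 0) / lam k = if i = k then (1 : ℝ) else 0 := by
    split_ifs <;> simp [(lampos k).ne']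
  rw [hlim] at key
  refine key.congr fun C => ?_
  have hkC : h k ^ C ≠ 0 := (Real.rpow_pos_of_pos (hpos k) C).ne'
  have hdiv : ∀ j, lam j * (h j / h k) ^ C = lam j * h j ^ C / h k ^ C := fun j => by
    rw [Real.div_rpow (hpos j).le (hpos k).le, mul_div_assoc]
  simp only [Pi.div_apply, hdiv, ← Finset.sum_div]
  exact div_div_div_cancel_right₀ hkC _ _

/-- Conditioning on the exclusion of `j` renormalizes the weights over the remaining indices. -/
theorem div_sum_div_one_sub_div_sum {ι : Type*} [Fintype ι] [DecidableEq ι] {w : ι → ℝ}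
    (hw : ∀ i, 0 < w i) (i j : ι) :
    w i / (∑ l, w l) / (1 - w j / ∑ l, w l) = w i / ∑ l ∈ univ.erase j, w l := by
  have hS : (∑ l, w l) ≠ 0 := (Finset.sum_pos (fun l _ => hw l) ⟨i, mem_univ i⟩).ne'
  rw [one_sub_div hS, div_div_div_cancel_right₀ hS,
    ← Finset.sum_erase_eq_sub (mem_univ j)]

/-- Second-stage sampling limit. With pairwise-distinct positive channels,
`m` the best-channel client and `m'` the second-best, first-stage probabilities
`ρ_i(C) = λ i * (h i)^C / (∑ j, λ j * (h j)^C)` and second-stage probabilities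
`ρ_i^{[2]}(C) = ∑_{j ≠ i} ρ_j(C) * ρ_i(C) / (1 − ρ_j(C))`, as `C → ∞` the second draw
concentrates on `m'`: `ρ_m^{[2]} → 0`, `ρ_{m'}^{[2]} → 1`, and `ρ_i^{[2]} → 0` otherwise. -/
theorem caafl_second_stage_limit (N : ℕ) (hN : 2 ≤ N) (h lam : Fin N → ℝ)
    (hpos : ∀ i, 0 < h i) (hinj : Function.Injective h) (lampos : ∀ i, 0 < lam i)
    (m m' : Fin N) (hne : m ≠ m')
    (hm : ∀ i, i ≠ m → h i < h m)
    (hm' : ∀ i, i ≠ m → i ≠ m' → h i < h m')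
    (ρ : Fin N → ℝ → ℝ)
    (hρ : ∀ i C, ρ i C = lam i * h i ^ C / ∑ j, lam j * h j ^ C)
    (ρ2 : Fin N → ℝ → ℝ)
    (hρ2 : ∀ i C, ρ2 i C = ∑ j ∈ univ.erase i, ρ j C * ρ i C / (1 - ρ j C)) :
    Tendsto (fun C => ρ2 m C) atTop (nhds 0) ∧
    Tendsto (fun C => ρ2 m' C) atTop (nhds 1) ∧
    ∀ i, i ≠ m → i ≠ m' → Tendsto (fun C => ρ2 i C) atTop (nhds 0) := by
  have hw : ∀ (C : ℝ) i, 0 < lam i * h i ^ C := fun C i =>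
    mul_pos (lampos i) (Real.rpow_pos_of_pos (hpos i) C)
  have first : ∀ j, Tendsto (ρ j) atTop (nhds (if j = m then 1 else 0)) := fun j =>
    (tendsto_weighted_rpow_div_sum hpos lampos (mem_univ m) (fun i _ hi => hm i hi)
      (mem_univ j)).congr fun C => (hρ j C).symm
  have second : ∀ i j, i ≠ j → Tendsto (fun C => ρ i C / (1 - ρ j C)) atTop
      (nhds (if i = (if j = m then m' else m) then 1 else 0)) := by
    intro i j hij
    simp only [hρ, div_sum_div_one_sub_div_sum (hw _)]
    refine tendsto_weighted_rpow_div_sum hpos lampos ?_ ?_ (by simp [hij])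
    · split_ifs with hj
      · simp [hj, hne.symm]
      · simp [Ne.symm hj]
    · intro l hl hl'
      split_ifs at hl' ⊢ with hj
      · exact hm' l (hj ▸ ne_of_mem_erase hl) hl'
      · exact hm l hl'
  have main : ∀ i, Tendsto (ρ2 i) atTop (nhds (if i = m' then 1 else 0)) := by
    intro i
    have hlim := tendsto_finsetSum (univ.erase i) fun j hj =>
      (first j).mul (second i j (ne_of_mem_erase hj).symm)
    have hval : (∑ j ∈ univ.erase i, (if j = m then (1 : ℝ) else 0) *
        (if i = (if j = m then m' else m) then 1 else 0)) = if i = m' then 1 else 0 := by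
      simp only [ite_mul, one_mul, zero_mul, Finset.sum_ite_eq', mem_erase, mem_univ, and_true]
      by_cases him : i = m
      · simp [him, hne]
      · simp [Ne.symm him]
    rw [hval] at hlim
    refine hlim.congr fun C => ?_
    simp only [hρ2, mul_div_assoc]
  exact ⟨by simpa [hne] using main m, by simpa using main m',
    fun i _ hi => by simpa [hi] using main i⟩
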